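/- Let z1, z2 > 0 and let μ_{MP,z1,z2} be the Marchenko–Pastur measure. Then for every z ∈ ℂ with Im z > 0, the Stieltjes transform Φ(z) = ∫ 1/(z−x) dμ_{MP,z1,z2}(x) satisfies the quadratic equation z2·z·Φ(z)² − (z − z1 + z2)·Φ(z) + 1 = 0 and Im Φ(z) < 0; equivalently, Φ(z) = (z − z1 + z2 − √((z−(z1+z2))² − 4·z1·z2))/(2·z2·z), where the square root denotes the unique square root with positive imaginary part. -/

import Mathlib

open MeasureTheory Real Filter Topology Polynomial

noncomputable section
/-- Density of the absolutely continuous part of the Marchenko-Pastur measure `μ_{MP,z1,z2}`. -/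
def mpDensity (z1 z2 : ℝ) (x : ℝ) : ℝ :=
  if x ∈ Set.Icc ((Real.sqrt z1 - Real.sqrt z2) ^ 2) ((Real.sqrt z1 + Real.sqrt z2) ^ 2) then
    Real.sqrt ((x - (Real.sqrt z1 - Real.sqrt z2) ^ 2) *
        ((Real.sqrt z1 + Real.sqrt z2) ^ 2 - x)) / (2 * π * z2 * x)
  else 0

/-- The Marchenko-Pastur measure `μ_{MP,z1,z2}`. -/
def muMP (z1 z2 : ℝ) : Measure ℝ :=
  ENNReal.ofReal (max (1 - z1 / z2) 0) • Measure.dirac 0 +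
    volume.withDensity (fun x => ENNReal.ofReal (mpDensity z1 z2 x))

lemma one_sub_two_mul_cos_add_sq (q : ℂ) (θ : ℝ) :
    1 - 2 * q * Complex.cos θ + q ^ 2 =
      (1 - q * Complex.exp (θ * Complex.I)) * (1 - q * Complex.exp (-(θ * Complex.I))) := by
  have h : Complex.exp (θ * Complex.I) * Complex.exp (-(θ * Complex.I)) = 1 := by
    rw [← Complex.exp_add]; simp
  rw [Complex.cos, neg_mul]
  linear_combination (-q ^ 2) * h

lemma one_sub_mul_exp_mem_slitPlane {q : ℂ} (hq : ‖q‖ < 1) (θ : ℝ) :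
    1 - q * Complex.exp (θ * Complex.I) ∈ Complex.slitPlane := by
  have := Complex.mem_slitPlane_of_norm_lt_one (z := -(q * Complex.exp (θ * Complex.I)))
    (by simpa [Complex.norm_exp_ofReal_mul_I] using hq)
  simpa [sub_eq_add_neg] using this

lemma one_sub_mul_exp_neg_mem_slitPlane {q : ℂ} (hq : ‖q‖ < 1) (θ : ℝ) :
    1 - q * Complex.exp (-(θ * Complex.I)) ∈ Complex.slitPlane := by
  simpa using one_sub_mul_exp_mem_slitPlane hq (-θ)

lemma one_sub_two_mul_cos_add_sq_ne_zero {q : ℂ} (hq : ‖q‖ < 1) (θ : ℝ) :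
    1 - 2 * q * Complex.cos θ + q ^ 2 ≠ 0 := by
  rw [one_sub_two_mul_cos_add_sq]
  exact mul_ne_zero (Complex.slitPlane_ne_zero (one_sub_mul_exp_mem_slitPlane hq θ))
    (Complex.slitPlane_ne_zero (one_sub_mul_exp_neg_mem_slitPlane hq θ))

lemma continuous_sin_sq_div {q : ℂ} (hq : ‖q‖ < 1) :
    Continuous fun θ : ℝ => Complex.sin θ ^ 2 / (1 - 2 * q * Complex.cos θ + q ^ 2) :=
  Continuous.div (by fun_prop) (by fun_prop) (one_sub_two_mul_cos_add_sq_ne_zero hq)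

/-- The Poisson kernel integrates to `π` over a half period. -/
lemma integral_poisson_kernel {q : ℂ} (hq : ‖q‖ < 1) :
    ∫ θ in (0 : ℝ)..π, (1 - q ^ 2) / (1 - 2 * q * Complex.cos θ + q ^ 2) = (π : ℂ) := by
  have hd : ∀ θ ∈ Set.uIcc 0 π, HasDerivAt
      (fun θ : ℝ => (θ : ℂ) + Complex.I * Complex.log (1 - q * Complex.exp (θ * Complex.I))
        - Complex.I * Complex.log (1 - q * Complex.exp (-(θ * Complex.I))))
      ((1 - q ^ 2) / (1 - 2 * q * Complex.cos θ + q ^ 2)) θ := by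
    intro θ _
    have h0 : HasDerivAt (fun θ : ℝ => (θ : ℂ)) 1 θ := Complex.ofRealCLM.hasDerivAt
    have h1 := (((h0.mul_const Complex.I).cexp.const_mul q).const_sub 1).clog_real
      (one_sub_mul_exp_mem_slitPlane hq θ)
    have h2 := (((h0.mul_const Complex.I).neg.cexp.const_mul q).const_sub 1).clog_real
      (one_sub_mul_exp_neg_mem_slitPlane hq θ)
    refine ((h0.add (h1.const_mul Complex.I)).sub (h2.const_mul Complex.I)).congr_deriv ?_
    have n1 := Complex.slitPlane_ne_zero (one_sub_mul_exp_mem_slitPlane hq θ)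
    have n2 := Complex.slitPlane_ne_zero (one_sub_mul_exp_neg_mem_slitPlane hq θ)
    have h : Complex.exp (θ * Complex.I) * Complex.exp (-(θ * Complex.I)) = 1 := by
      rw [← Complex.exp_add]; simp
    rw [one_sub_two_mul_cos_add_sq]
    simp only [Pi.neg_apply]
    generalize Complex.exp (θ * Complex.I) = u at *
    generalize Complex.exp (-(θ * Complex.I)) = v at *
    field_simp
    ring_nf
    rw [Complex.I_sq]
    linear_combination (-q ^ 2) * h
  rw [intervalIntegral.integral_eq_sub_of_hasDerivAt hd]
  · simp [Complex.exp_neg]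
  · exact (Continuous.div (by fun_prop) (by fun_prop)
      (one_sub_two_mul_cos_add_sq_ne_zero hq)).intervalIntegrable _ _

lemma integral_sin_sq_div {q : ℂ} (hq : ‖q‖ < 1) (hq0 : q ≠ 0) :
    ∫ θ in (0 : ℝ)..π, Complex.sin θ ^ 2 / (1 - 2 * q * Complex.cos θ + q ^ 2) = (π : ℂ) / 2 := by
  have h : ∀ θ : ℝ, Complex.sin θ ^ 2 / (1 - 2 * q * Complex.cos θ + q ^ 2) =
      (1 + q ^ 2) / (4 * q ^ 2) + 1 / (2 * q) * Complex.cos θ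
        - (1 - q ^ 2) / (4 * q ^ 2) *
          ((1 - q ^ 2) / (1 - 2 * q * Complex.cos θ + q ^ 2)) := by
    intro θ
    have := one_sub_two_mul_cos_add_sq_ne_zero hq θ
    rw [Complex.sin_sq]
    generalize hD : 1 - 2 * q * Complex.cos θ + q ^ 2 = D at *
    field_simp
    rw [← hD]
    ring
  have hc : ∫ θ in (0 : ℝ)..π, Complex.cos θ = 0 := by
    simp only [← Complex.ofReal_cos]
    rw [intervalIntegral.integral_ofReal]; simp
  have hK : Continuous fun θ : ℝ => (1 - q ^ 2) / (1 - 2 * q * Complex.cos θ + q ^ 2) :=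
    Continuous.div (by fun_prop) (by fun_prop) (one_sub_two_mul_cos_add_sq_ne_zero hq)
  simp_rw [h]
  rw [intervalIntegral.integral_sub, intervalIntegral.integral_add,
    intervalIntegral.integral_const_mul, intervalIntegral.integral_const_mul,
    integral_poisson_kernel hq, hc, intervalIntegral.integral_const]
  · simp only [sub_zero, Complex.real_smul]
    field_simp
    ring
  all_goals exact Continuous.intervalIntegrable (by fun_prop) _ _

/-- The Joukowski parametrization of the upper half plane. -/
lemma exists_joukowski {ζ : ℂ} (hζ : 0 < ζ.im) :
    ∃ q : ℂ, q ≠ 0 ∧ ‖q‖ < 1 ∧ 2 * ζ = q⁻¹ + q ∧ 0 < (q⁻¹ - q).im := by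
  obtain ⟨v, hv⟩ := IsAlgClosed.exists_pow_nat_eq (ζ ^ 2 - 1) (n := 2) (by norm_num)
  have key : ∀ q p : ℂ, q * p = 1 → q + p = 2 * ζ → ‖q‖ < 1 →
      ∃ q : ℂ, q ≠ 0 ∧ ‖q‖ < 1 ∧ 2 * ζ = q⁻¹ + q ∧ 0 < (q⁻¹ - q).im := by
    intro q p hqp hs hq
    have hq0 : q ≠ 0 := left_ne_zero_of_mul_eq_one hqp
    have hp : p = q⁻¹ := (inv_eq_of_mul_eq_one_right hqp).symm
    subst hp
    refine ⟨q, hq0, hq, by rw [← hs, add_comm], ?_⟩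
    have hn : 0 < Complex.normSq q := Complex.normSq_pos.2 hq0
    have hn1 : Complex.normSq q < 1 := by
      rw [Complex.normSq_eq_norm_sq]; nlinarith [norm_nonneg q]
    have him := congrArg Complex.im hs
    simp only [Complex.add_im, Complex.inv_im, Complex.mul_im, Complex.re_ofNat,
      Complex.im_ofNat] at him
    have e : -q.im / Complex.normSq q * Complex.normSq q = -q.im := by field_simp
    have hqi : q.im < 0 := by
      by_contra! hc
      nlinarith [mul_pos hζ hn]
    simp only [Complex.sub_im, Complex.inv_im]
    have : 0 < -q.im / Complex.normSq q := by apply div_pos <;> linarith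
    linarith
  have hprod : (ζ - v) * (ζ + v) = 1 := by linear_combination -hv
  rcases lt_trichotomy ‖ζ - v‖ 1 with h | h | h
  · exact key _ _ hprod (by ring) h
  · exfalso
    have hn : Complex.normSq (ζ - v) = 1 := by rw [Complex.normSq_eq_norm_sq, h]; norm_num
    have hp : ζ + v = (ζ - v)⁻¹ := (inv_eq_of_mul_eq_one_right hprod).symm
    have him := congrArg Complex.im hp
    rw [Complex.inv_im, hn] at him
    simp only [Complex.add_im, Complex.sub_im] at him
    linarith
  · refine key _ _ ((mul_comm _ _).trans hprod) (by ring) ?_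
    have := congrArg norm hprod
    rw [norm_mul, norm_one] at this
    by_contra! hc
    nlinarith

lemma intervalIntegrable_and_integral_sin_sq_div_of_le {s t : ℝ} (hs : 0 < s) (hst : s ≤ t) :
    IntervalIntegrable (fun θ : ℝ => Complex.sin θ ^ 2 /
      ((s : ℂ) ^ 2 + (t : ℂ) ^ 2 + 2 * s * t * Complex.cos θ)) volume 0 π ∧
    ∫ θ in (0 : ℝ)..π, Complex.sin θ ^ 2 /
      ((s : ℂ) ^ 2 + (t : ℂ) ^ 2 + 2 * s * t * Complex.cos θ) = (π : ℂ) / (2 * t ^ 2) := by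
  have ht : 0 < t := hs.trans_le hst
  have ht0 : (t : ℂ) ≠ 0 := by exact_mod_cast ht.ne'
  have hs0 : (s : ℂ) ≠ 0 := by exact_mod_cast hs.ne'
  rcases hst.lt_or_eq with h | rfl
  · set q : ℂ := -(s / t) with hq
    have hq1 : ‖q‖ < 1 := by
      rw [hq, norm_neg, norm_div, Complex.norm_real, Complex.norm_real, Real.norm_of_nonneg hs.le,
        Real.norm_of_nonneg ht.le]
      exact (div_lt_one ht).2 h
    have hq0 : q ≠ 0 := neg_ne_zero.2 (div_ne_zero hs0 ht0)
    have e : (fun θ : ℝ => Complex.sin θ ^ 2 /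
        ((s : ℂ) ^ 2 + (t : ℂ) ^ 2 + 2 * s * t * Complex.cos θ)) = fun θ : ℝ =>
        (1 / (t : ℂ) ^ 2) * (Complex.sin θ ^ 2 / (1 - 2 * q * Complex.cos θ + q ^ 2)) := by
      funext θ
      have : (s : ℂ) ^ 2 + (t : ℂ) ^ 2 + 2 * s * t * Complex.cos θ =
          t ^ 2 * (1 - 2 * q * Complex.cos θ + q ^ 2) := by
        rw [hq]; field_simp; ring
      rw [this, div_mul_div_comm, one_mul]
    rw [e]
    refine ⟨((continuous_sin_sq_div hq1).const_mul _).intervalIntegrable _ _, ?_⟩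
    rw [intervalIntegral.integral_const_mul, integral_sin_sq_div hq1 hq0]
    field_simp
  · have e : Set.EqOn (fun θ : ℝ => (1 - Complex.cos θ) / (2 * (s : ℂ) ^ 2))
        (fun θ : ℝ => Complex.sin θ ^ 2 /
        ((s : ℂ) ^ 2 + (s : ℂ) ^ 2 + 2 * s * s * Complex.cos θ)) (Set.Ioo 0 π) := by
      intro θ hθ
      have hc : 1 + Complex.cos θ ≠ 0 := by
        have : -1 < Real.cos θ := by
          rw [← Real.cos_pi]
          exact Real.cos_lt_cos_of_nonneg_of_le_pi hθ.1.le le_rfl hθ.2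
        rw [← Complex.ofReal_cos]
        exact_mod_cast (by linarith : (0 : ℝ) < 1 + Real.cos θ).ne'
      have : (s : ℂ) ^ 2 + (s : ℂ) ^ 2 + 2 * s * s * Complex.cos θ =
        2 * s ^ 2 * (1 + Complex.cos θ) := by ring
      simp only [this, Complex.sin_sq]
      field_simp
      ring
    have hi : IntervalIntegrable (fun θ : ℝ => (1 - Complex.cos θ) / (2 * (s : ℂ) ^ 2))
      volume 0 π := Continuous.intervalIntegrable (by fun_prop) _ _
    have hc : ∫ θ in (0 : ℝ)..π, Complex.cos θ = 0 := by
      simp only [← Complex.ofReal_cos]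
      rw [intervalIntegral.integral_ofReal]; simp
    rw [intervalIntegrable_iff_integrableOn_Ioo_of_le pi_pos.le] at hi ⊢
    refine ⟨hi.congr_fun e measurableSet_Ioo, ?_⟩
    rw [intervalIntegral.integral_of_le pi_pos.le, integral_Ioc_eq_integral_Ioo,
      ← setIntegral_congr_fun measurableSet_Ioo e, ← integral_Ioc_eq_integral_Ioo,
      ← intervalIntegral.integral_of_le pi_pos.le, intervalIntegral.integral_div,
      intervalIntegral.integral_sub, hc]
    · simp
    all_goals exact Continuous.intervalIntegrable (by fun_prop) _ _

lemma intervalIntegrable_and_integral_sin_sq_div {s t : ℝ} (hs : 0 < s) (ht : 0 < t) :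
    IntervalIntegrable (fun θ : ℝ => Complex.sin θ ^ 2 /
      ((s : ℂ) ^ 2 + (t : ℂ) ^ 2 + 2 * s * t * Complex.cos θ)) volume 0 π ∧
    ∫ θ in (0 : ℝ)..π, Complex.sin θ ^ 2 /
      ((s : ℂ) ^ 2 + (t : ℂ) ^ 2 + 2 * s * t * Complex.cos θ) =
        (π : ℂ) / (2 * (max s t : ℝ) ^ 2) := by
  rcases le_total s t with h | h
  · rw [max_eq_right h]
    exact intervalIntegrable_and_integral_sin_sq_div_of_le hs h
  · have := intervalIntegrable_and_integral_sin_sq_div_of_le ht h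
    rw [max_eq_left h]
    simpa only [add_comm ((t : ℂ) ^ 2), mul_right_comm (2 : ℂ) (t : ℂ)] using this

lemma image_sq_add_sq_add_cos {s t : ℝ} (hs : 0 < s) (ht : 0 < t) :
    (fun θ => s ^ 2 + t ^ 2 + 2 * s * t * Real.cos θ) '' Set.Icc 0 π =
      Set.Icc ((s - t) ^ 2) ((s + t) ^ 2) := by
  have h : (fun θ => s ^ 2 + t ^ 2 + 2 * s * t * Real.cos θ) =
    (fun y => 2 * s * t * y + (s ^ 2 + t ^ 2)) ∘ Real.cos := by
    funext θ; simp only [Function.comp]; ring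
  rw [h, Set.image_comp, Real.bijOn_cos.image_eq, Set.image_affine_Icc' (by positivity)]
  congr 1 <;> ring

lemma mpDensity_sq_add_sq_add_cos {s t θ : ℝ} (hs : 0 < s) (ht : 0 < t) (hθ : θ ∈ Set.Icc 0 π) :
    mpDensity (s ^ 2) (t ^ 2) (s ^ 2 + t ^ 2 + 2 * s * t * Real.cos θ) =
      2 * s * t * Real.sin θ / (2 * π * t ^ 2 * (s ^ 2 + t ^ 2 + 2 * s * t * Real.cos θ)) := by
  have hmem := Set.mem_image_of_mem (fun θ => s ^ 2 + t ^ 2 + 2 * s * t * Real.cos θ) hθ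
  rw [image_sq_add_sq_add_cos hs ht] at hmem
  rw [mpDensity, Real.sqrt_sq hs.le, Real.sqrt_sq ht.le, if_pos hmem]
  congr 1
  rw [Real.sqrt_eq_iff_mul_self_eq]
  · linear_combination (-4 * s ^ 2 * t ^ 2) * Real.sin_sq_add_cos_sq θ
  · exact mul_nonneg (sub_nonneg.2 hmem.1) (sub_nonneg.2 hmem.2)
  · have := Real.sin_nonneg_of_mem_Icc hθ
    positivity

lemma mpDensity_nonneg {z1 z2 : ℝ} (hz2 : 0 < z2) (x : ℝ) : 0 ≤ mpDensity z1 z2 x := by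
  unfold mpDensity
  split_ifs with h
  · have : 0 ≤ x := (sq_nonneg _).trans h.1
    have := pi_pos
    positivity
  · exact le_rfl

lemma measurable_mpDensity (z1 z2 : ℝ) : Measurable (mpDensity z1 z2) := by
  unfold mpDensity
  exact Measurable.ite measurableSet_Icc (by fun_prop) measurable_const

lemma abs_deriv_smul_mpDensity_mul {s t θ : ℝ} (hs : 0 < s) (ht : 0 < t)
    (hθ : θ ∈ Set.Icc 0 π) (g : ℝ → ℂ) :
    |2 * s * t * -Real.sin θ| • ((mpDensity (s ^ 2) (t ^ 2)
        (s ^ 2 + t ^ 2 + 2 * s * t * Real.cos θ) : ℂ) *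
        g (s ^ 2 + t ^ 2 + 2 * s * t * Real.cos θ)) =
      (2 * s ^ 2 / π : ℂ) * (Complex.sin θ ^ 2 /
        ((s : ℂ) ^ 2 + (t : ℂ) ^ 2 + 2 * s * t * Complex.cos θ) *
        g (s ^ 2 + t ^ 2 + 2 * s * t * Real.cos θ)) := by
  have hsin := Real.sin_nonneg_of_mem_Icc hθ
  have ht0 : (t : ℂ) ≠ 0 := by exact_mod_cast ht.ne'
  have hpi : (π : ℂ) ≠ 0 := by exact_mod_cast pi_ne_zero
  rw [mpDensity_sq_add_sq_add_cos hs ht hθ, mul_neg, abs_neg, abs_of_nonneg (by positivity),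
    Complex.real_smul]
  push_cast
  rw [← mul_assoc, ← mul_assoc]
  congr 1
  generalize (s : ℂ) ^ 2 + (t : ℂ) ^ 2 + 2 * s * t * Complex.cos θ = D
  rw [← div_div]
  field_simp

lemma hasDerivWithinAt_sq_add_sq_add_cos (s t θ : ℝ) (S : Set ℝ) :
    HasDerivWithinAt (fun θ => s ^ 2 + t ^ 2 + 2 * s * t * Real.cos θ)
      (2 * s * t * -Real.sin θ) S θ :=
  (((Real.hasDerivAt_cos θ).const_mul (2 * s * t)).const_add (s ^ 2 + t ^ 2)).hasDerivWithinAt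

lemma injOn_sq_add_sq_add_cos {s t : ℝ} (hs : 0 < s) (ht : 0 < t) :
    Set.InjOn (fun θ => s ^ 2 + t ^ 2 + 2 * s * t * Real.cos θ) (Set.Icc 0 π) := by
  intro a ha b hb h
  exact Real.injOn_cos ha hb (mul_left_cancel₀ (by positivity) (add_left_cancel h))

lemma mpDensity_eq_zero_of_notMem {s t x : ℝ} (hs : 0 < s) (ht : 0 < t)
    (hx : x ∉ Set.Icc ((s - t) ^ 2) ((s + t) ^ 2)) : mpDensity (s ^ 2) (t ^ 2) x = 0 := by
  rw [mpDensity, Real.sqrt_sq hs.le, Real.sqrt_sq ht.le, if_neg hx]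

lemma integral_mpDensity_mul {s t : ℝ} (hs : 0 < s) (ht : 0 < t) (g : ℝ → ℂ) :
    ∫ x, (mpDensity (s ^ 2) (t ^ 2) x : ℂ) * g x =
      (2 * s ^ 2 / π : ℂ) * ∫ θ in (0 : ℝ)..π, Complex.sin θ ^ 2 /
        ((s : ℂ) ^ 2 + (t : ℂ) ^ 2 + 2 * s * t * Complex.cos θ) *
        g (s ^ 2 + t ^ 2 + 2 * s * t * Real.cos θ) := by
  rw [← setIntegral_eq_integral_of_forall_compl_eq_zero
      (s := Set.Icc ((s - t) ^ 2) ((s + t) ^ 2)),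
    ← image_sq_add_sq_add_cos hs ht, integral_image_eq_integral_abs_deriv_smul measurableSet_Icc
      (fun θ _ => hasDerivWithinAt_sq_add_sq_add_cos s t θ _) (injOn_sq_add_sq_add_cos hs ht),
    setIntegral_congr_fun measurableSet_Icc
      (fun θ hθ => abs_deriv_smul_mpDensity_mul hs ht hθ g),
    integral_const_mul, integral_Icc_eq_integral_Ioc, intervalIntegral.integral_of_le pi_pos.le]
  intro x hx
  simp [mpDensity_eq_zero_of_notMem hs ht hx]

lemma integrable_mpDensity {s t : ℝ} (hs : 0 < s) (ht : 0 < t) :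
    Integrable (mpDensity (s ^ 2) (t ^ 2)) := by
  have key : IntegrableOn (fun x => (mpDensity (s ^ 2) (t ^ 2) x : ℂ) * (fun _ => 1) x)
      (Set.Icc ((s - t) ^ 2) ((s + t) ^ 2)) := by
    rw [← image_sq_add_sq_add_cos hs ht, integrableOn_image_iff_integrableOn_abs_deriv_smul
      measurableSet_Icc (fun θ _ => hasDerivWithinAt_sq_add_sq_add_cos s t θ _)
      (injOn_sq_add_sq_add_cos hs ht), integrableOn_congr_fun
        (fun θ hθ => abs_deriv_smul_mpDensity_mul hs ht hθ (fun _ => 1)) measurableSet_Icc]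
    simp only [mul_one]
    refine Integrable.const_mul ?_ _
    have := (intervalIntegrable_and_integral_sin_sq_div hs ht).1
    rwa [intervalIntegrable_iff_integrableOn_Icc_of_le pi_pos.le] at this
  rw [integrableOn_iff_integrable_of_support_subset] at key
  · simpa using key.re
  · intro x hx
    by_contra h
    simp [mpDensity_eq_zero_of_notMem hs ht h] at hx

lemma sub_ofReal_ne_zero {z : ℂ} (hz : 0 < z.im) (x : ℝ) : z - x ≠ 0 := by
  intro h
  have := congrArg Complex.im h
  simp at this
  exact hz.ne' this

lemma integrable_resolvent {z : ℂ} (hz : 0 < z.im) (μ : Measure ℝ) [IsFiniteMeasure μ] :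
    Integrable (fun x : ℝ => (z - (x : ℂ))⁻¹) μ := by
  refine Integrable.of_bound (C := z.im⁻¹) (by fun_prop) (ae_of_all _ fun x => ?_)
  rw [norm_inv]
  gcongr
  have := (le_abs_self _).trans (Complex.abs_im_le_norm (z - (x : ℂ)))
  simpa using this

lemma isFiniteMeasure_withDensity_mpDensity {s t : ℝ} (hs : 0 < s) (ht : 0 < t) :
    IsFiniteMeasure (volume.withDensity
      fun x => ENNReal.ofReal (mpDensity (s ^ 2) (t ^ 2) x)) :=
  isFiniteMeasure_withDensity_ofReal (integrable_mpDensity hs ht).2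

lemma isFiniteMeasure_muMP {s t : ℝ} (hs : 0 < s) (ht : 0 < t) :
    IsFiniteMeasure (muMP (s ^ 2) (t ^ 2)) := by
  have := isFiniteMeasure_withDensity_mpDensity hs ht
  have := Measure.smul_finite (Measure.dirac (0 : ℝ))
    (c := ENNReal.ofReal (max (1 - s ^ 2 / t ^ 2) 0)) ENNReal.ofReal_ne_top
  unfold muMP
  infer_instance

lemma integral_resolvent_muMP {s t : ℝ} (hs : 0 < s) (ht : 0 < t) {z : ℂ} (hz : 0 < z.im) :
    ∫ x, (z - (x : ℂ))⁻¹ ∂(muMP (s ^ 2) (t ^ 2)) =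
      (max (1 - s ^ 2 / t ^ 2) 0 : ℝ) * z⁻¹ +
        ∫ x, (mpDensity (s ^ 2) (t ^ 2) x : ℂ) * (z - (x : ℂ))⁻¹ := by
  have := isFiniteMeasure_withDensity_mpDensity hs ht
  have := Measure.smul_finite (Measure.dirac (0 : ℝ))
    (c := ENNReal.ofReal (max (1 - s ^ 2 / t ^ 2) 0)) ENNReal.ofReal_ne_top
  rw [muMP, integral_add_measure (integrable_resolvent hz _) (integrable_resolvent hz _),
    integral_smul_measure, integral_dirac, integral_withDensity_eq_integral_toReal_smul
      (measurable_mpDensity _ _).ennreal_ofReal (ae_of_all _ fun _ => ENNReal.ofReal_lt_top)]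
  simp only [ENNReal.toReal_ofReal (mpDensity_nonneg (pow_pos ht 2) _),
    ENNReal.toReal_ofReal (le_max_right _ _), Complex.real_smul, Complex.ofReal_zero, sub_zero]

lemma integral_sin_sq_div_mul_resolvent {s t : ℝ} (hs : 0 < s) (ht : 0 < t) {z q : ℂ}
    (hz : 0 < z.im) (hq0 : q ≠ 0) (hq : ‖q‖ < 1)
    (hzq : z - (s ^ 2 + t ^ 2) = s * t * (q⁻¹ + q)) :
    ∫ θ in (0 : ℝ)..π, Complex.sin θ ^ 2 /
        ((s : ℂ) ^ 2 + (t : ℂ) ^ 2 + 2 * s * t * Complex.cos θ) *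
        (z - ((s ^ 2 + t ^ 2 + 2 * s * t * Real.cos θ : ℝ) : ℂ))⁻¹ =
      z⁻¹ * ((π : ℂ) / (2 * (max s t : ℝ) ^ 2) + q / (s * t) * (π / 2)) := by
  have hs0 : (s : ℂ) ≠ 0 := by exact_mod_cast hs.ne'
  have ht0 : (t : ℂ) ≠ 0 := by exact_mod_cast ht.ne'
  have hz0 : z ≠ 0 := by simpa using sub_ofReal_ne_zero hz 0
  obtain ⟨hi, hI⟩ := intervalIntegrable_and_integral_sin_sq_div hs ht
  have e : Set.EqOn (fun θ : ℝ => Complex.sin θ ^ 2 /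
        ((s : ℂ) ^ 2 + (t : ℂ) ^ 2 + 2 * s * t * Complex.cos θ) *
        (z - ((s ^ 2 + t ^ 2 + 2 * s * t * Real.cos θ : ℝ) : ℂ))⁻¹)
      (fun θ : ℝ => z⁻¹ * (Complex.sin θ ^ 2 /
        ((s : ℂ) ^ 2 + (t : ℂ) ^ 2 + 2 * s * t * Complex.cos θ) +
        q / (s * t) * (Complex.sin θ ^ 2 / (1 - 2 * q * Complex.cos θ + q ^ 2))))
      (Set.Ioo 0 π) := by
    intro θ hθ
    have hd := one_sub_two_mul_cos_add_sq_ne_zero hq θ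
    have hx : (s : ℂ) ^ 2 + (t : ℂ) ^ 2 + 2 * s * t * Complex.cos θ ≠ 0 := by
      have h1 : -1 < Real.cos θ := by
        rw [← Real.cos_pi]
        exact Real.cos_lt_cos_of_nonneg_of_le_pi hθ.1.le le_rfl hθ.2
      have : 0 < s ^ 2 + t ^ 2 + 2 * s * t * Real.cos θ := by
        nlinarith [sq_nonneg (s - t), mul_pos (mul_pos hs ht) (by linarith : 0 < 1 + Real.cos θ)]
      rw [← Complex.ofReal_cos]
      exact_mod_cast this.ne'
    have hr : z - ((s : ℂ) ^ 2 + (t : ℂ) ^ 2 + 2 * s * t * Complex.cos θ) =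
        s * t / q * (1 - 2 * q * Complex.cos θ + q ^ 2) := by
      have : z = s * t * (q⁻¹ + q) + (s ^ 2 + t ^ 2) := by rw [← hzq]; ring
      rw [this]; field_simp; ring
    have hr' : s * t * (1 - 2 * q * Complex.cos θ + q ^ 2) =
      q * (z - ((s : ℂ) ^ 2 + (t : ℂ) ^ 2 + 2 * s * t * Complex.cos θ)) := by
      rw [hr]; field_simp
    push_cast
    simp only [hr]
    generalize 1 - 2 * q * Complex.cos θ + q ^ 2 = D at *
    generalize (s : ℂ) ^ 2 + (t : ℂ) ^ 2 + 2 * s * t * Complex.cos θ = X at *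
    field_simp
    linear_combination (-Complex.sin θ ^ 2) * hr'
  rw [intervalIntegral.integral_of_le pi_pos.le, integral_Ioc_eq_integral_Ioo,
    setIntegral_congr_fun measurableSet_Ioo e, ← integral_Ioc_eq_integral_Ioo,
    ← intervalIntegral.integral_of_le pi_pos.le, intervalIntegral.integral_const_mul,
    intervalIntegral.integral_add hi
      (((continuous_sin_sq_div hq).const_mul _).intervalIntegrable _ _),
    intervalIntegral.integral_const_mul, hI, integral_sin_sq_div hq hq0]

lemma integral_resolvent_muMP_eq {s t : ℝ} (hs : 0 < s) (ht : 0 < t) {z q : ℂ}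
    (hz : 0 < z.im) (hq0 : q ≠ 0) (hq : ‖q‖ < 1)
    (hzq : z - (s ^ 2 + t ^ 2) = s * t * (q⁻¹ + q)) :
    ∫ x, (z - (x : ℂ))⁻¹ ∂(muMP (s ^ 2) (t ^ 2)) =
      (z - s ^ 2 + t ^ 2 - s * t * (q⁻¹ - q)) / (2 * t ^ 2 * z) := by
  have hs0 : (s : ℂ) ≠ 0 := by exact_mod_cast hs.ne'
  have ht0 : (t : ℂ) ≠ 0 := by exact_mod_cast ht.ne'
  have hpi : (π : ℂ) ≠ 0 := by exact_mod_cast pi_ne_zero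
  have hz0 : z ≠ 0 := by simpa using sub_ofReal_ne_zero hz 0
  rw [integral_resolvent_muMP hs ht hz, integral_mpDensity_mul hs ht,
    integral_sin_sq_div_mul_resolvent hs ht hz hq0 hq hzq]
  have hzq' : z - s ^ 2 + t ^ 2 - s * t * (q⁻¹ - q) = 2 * t ^ 2 + 2 * s * t * q := by
    linear_combination hzq
  rw [hzq']
  rcases le_total s t with h | h
  · have h1 : 0 ≤ 1 - s ^ 2 / t ^ 2 := by
      rw [sub_nonneg, div_le_one (by positivity)]; gcongr
    rw [max_eq_left h1, max_eq_right h]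
    push_cast
    field_simp
    ring
  · have h1 : 1 - s ^ 2 / t ^ 2 ≤ 0 := by
      rw [sub_nonpos, one_le_div (by positivity)]; gcongr
    rw [max_eq_right h1, max_eq_left h]
    push_cast
    field_simp
    ring

/-- The Stieltjes transform of a nonzero finite measure maps the upper half plane to the lower
half plane. -/
lemma im_integral_resolvent_neg {z : ℂ} (hz : 0 < z.im) (μ : Measure ℝ) [IsFiniteMeasure μ]
    (hμ : μ ≠ 0) : (∫ x, (z - (x : ℂ))⁻¹ ∂μ).im < 0 := by
  have hi := integrable_resolvent hz μ
  have him : (∫ x, (z - (x : ℂ))⁻¹ ∂μ).im = ∫ x, ((z - (x : ℂ))⁻¹).im ∂μ :=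
    (integral_im hi).symm
  have hpos : ∀ x : ℝ, 0 < -((z - (x : ℂ))⁻¹).im := by
    intro x
    have : 0 < Complex.normSq (z - x) := Complex.normSq_pos.2 (sub_ofReal_ne_zero hz x)
    simp only [Complex.inv_im, Complex.sub_im, Complex.ofReal_im, sub_zero, neg_div, neg_neg]
    positivity
  rw [him, ← neg_pos, ← integral_neg, integral_pos_iff_support_of_nonneg
    (fun x => (hpos x).le) hi.im.neg]
  have : Function.support (fun x : ℝ => -((z - (x : ℂ))⁻¹).im) = Set.univ :=
    Function.support_eq_univ fun x => (hpos x).ne'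
  rw [this, Measure.measure_univ_pos]
  exact hμ

/-- The Stieltjes transform of the Marchenko-Pastur measure satisfies
`z₂ z Φ(z)² - (z - z₁ + z₂) Φ(z) + 1 = 0` and `Im Φ(z) < 0` on the upper half plane;
equivalently `Φ(z) = (z - z₁ + z₂ - √((z-(z₁+z₂))² - 4 z₁ z₂))/(2 z₂ z)` with the square
root of positive imaginary part. -/
theorem statement13 (z1 z2 : ℝ) (hz1 : 0 < z1) (hz2 : 0 < z2) (z : ℂ) (hz : 0 < z.im)
    (Φ : ℂ) (hΦ : Φ = ∫ x, (z - (x : ℂ))⁻¹ ∂(muMP z1 z2)) :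
    (z2 : ℂ) * z * Φ ^ 2 - (z - (z1 : ℂ) + (z2 : ℂ)) * Φ + 1 = 0 ∧ Φ.im < 0 ∧
      (∃ w : ℂ, w ^ 2 = (z - ((z1 : ℂ) + (z2 : ℂ))) ^ 2 - 4 * (z1 : ℂ) * (z2 : ℂ) ∧ 0 < w.im) ∧
      (∀ w : ℂ, w ^ 2 = (z - ((z1 : ℂ) + (z2 : ℂ))) ^ 2 - 4 * (z1 : ℂ) * (z2 : ℂ) → 0 < w.im →
        Φ = (z - (z1 : ℂ) + (z2 : ℂ) - w) / (2 * (z2 : ℂ) * z)) := by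
  obtain ⟨s, hs, rfl⟩ : ∃ s : ℝ, 0 < s ∧ s ^ 2 = z1 :=
    ⟨Real.sqrt z1, Real.sqrt_pos.2 hz1, Real.sq_sqrt hz1.le⟩
  obtain ⟨t, ht, rfl⟩ : ∃ t : ℝ, 0 < t ∧ t ^ 2 = z2 :=
    ⟨Real.sqrt z2, Real.sqrt_pos.2 hz2, Real.sq_sqrt hz2.le⟩
  have hs0 : (s : ℂ) ≠ 0 := by exact_mod_cast hs.ne'
  have ht0 : (t : ℂ) ≠ 0 := by exact_mod_cast ht.ne'
  have hz0 : z ≠ 0 := by simpa using sub_ofReal_ne_zero hz 0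
  have hζ : 0 < ((z - ((s ^ 2 + t ^ 2 : ℝ) : ℂ)) / ((2 * s * t : ℝ) : ℂ)).im := by
    rw [Complex.div_ofReal_im, Complex.sub_im, Complex.ofReal_im, sub_zero]
    positivity
  obtain ⟨q, hq0, hq, hζq, hw⟩ := exists_joukowski hζ
  have hzq : z - (s ^ 2 + t ^ 2) = s * t * (q⁻¹ + q) := by
    rw [← hζq]; push_cast; field_simp
  have hΦq := integral_resolvent_muMP_eq hs ht hz hq0 hq hzq
  rw [← hΦ] at hΦq
  have hw0 : (s * t * (q⁻¹ - q)) ^ 2 = (z - (s ^ 2 + t ^ 2)) ^ 2 - 4 * s ^ 2 * t ^ 2 := by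
    rw [hzq]; field_simp; ring
  have hw0im : 0 < (s * t * (q⁻¹ - q)).im := by
    rw [mul_assoc, Complex.im_ofReal_mul, Complex.im_ofReal_mul]
    positivity
  generalize (s * t * (q⁻¹ - q) : ℂ) = w0 at hΦq hw0 hw0im
  have hquad : (t : ℂ) ^ 2 * z * Φ ^ 2 - (z - s ^ 2 + t ^ 2) * Φ + 1 = 0 := by
    rw [hΦq]
    field_simp
    linear_combination hw0
  push_cast
  refine ⟨hquad, ?_, ⟨w0, hw0, hw0im⟩, fun w hw hwim => ?_⟩
  · have := isFiniteMeasure_muMP hs ht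
    rw [hΦ]
    refine im_integral_resolvent_neg hz _ fun h => ?_
    rw [h, integral_zero_measure] at hΦ
    simp [hΦ] at hquad
  · rcases sq_eq_sq_iff_eq_or_eq_neg.1 (hw.trans hw0.symm) with rfl | rfl
    · exact hΦq
    · rw [Complex.neg_im] at hwim
      linarith

end
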